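/- Let R be a commutative ring that is finitely generated as a ring (equivalently, finitely generated as a ℤ-algebra). If R is elementarily equivalent to ℤ in the first-order language of rings, then R is isomorphic to ℤ as a ring. -/

import Mathlib

open FirstOrder

/-- `x` is a sum of four squares. -/
def IsSumFourSq {A : Type} [CommRing A] (x : A) : Prop :=
  ∃ a b c d : A, x = a * a + b * b + c * c + d * d

theorem isSumFourSq_natCast {A : Type} [CommRing A] (n : ℕ) : IsSumFourSq (n : A) := by
  obtain ⟨a, b, c, d, h⟩ := Nat.sum_four_squares n
  refine ⟨a, b, c, d, ?_⟩
  rw [← h]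
  push_cast
  ring

theorem int_isSumFourSq_iff (x : ℤ) : IsSumFourSq x ↔ 0 ≤ x := by
  constructor
  · rintro ⟨a, b, c, d, rfl⟩
    nlinarith [mul_self_nonneg a, mul_self_nonneg b, mul_self_nonneg c, mul_self_nonneg d]
  · intro hx
    lift x to ℕ using hx
    exact isSumFourSq_natCast x

/-- The formula saying that `t` is a sum of four squares, where the squared variables are the
four de Bruijn levels following `n`. -/
def sumFourSqFormula (n : ℕ) (t : Language.ring.Term (Empty ⊕ Fin (n + 4))) :
    Language.ring.BoundedFormula Empty n :=
  ∃' ∃' ∃' ∃' (t =' (Language.Term.var (Sum.inr ⟨n, by omega⟩) *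
        Language.Term.var (Sum.inr ⟨n, by omega⟩) +
      Language.Term.var (Sum.inr ⟨n + 1, by omega⟩) *
        Language.Term.var (Sum.inr ⟨n + 1, by omega⟩) +
      Language.Term.var (Sum.inr ⟨n + 2, by omega⟩) *
        Language.Term.var (Sum.inr ⟨n + 2, by omega⟩) +
      Language.Term.var (Sum.inr ⟨n + 3, by omega⟩) *
        Language.Term.var (Sum.inr ⟨n + 3, by omega⟩)))

/-- A ring without zero divisors in which `2` is not a unit, whose sums of four squares behave
like the natural numbers, and in which every initial segment has a nonzero common multiple. -/
structure IntLike (A : Type) [CommRing A] : Prop where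
  eq_zero_or_eq_zero : ∀ x y : A, x * y = 0 → x = 0 ∨ y = 0
  two_mul_ne_one : ∀ x : A, (1 + 1) * x ≠ 1
  not_isSumFourSq_neg_one : ¬ IsSumFourSq (-1 : A)
  isSumFourSq_or_neg : ∀ x : A, IsSumFourSq x ∨ IsSumFourSq (-x)
  eq_zero_or_sub_one : ∀ x : A, IsSumFourSq x → x = 0 ∨ IsSumFourSq (x + -1)
  exists_common_multiple : ∀ x : A, ∃ m : A, m ≠ 0 ∧
    ∀ k : A, IsSumFourSq k → IsSumFourSq (x + -k) → k ≠ 0 → ∃ l : A, m = k * l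

/-- The first-order sentence expressing `IntLike`. -/
def intLikeSentence : Language.ring.Sentence :=
  (∀' ∀' ((&0 * &1) =' 0 ⟹ (&0 =' 0 ⊔ &1 =' 0))) ⊓
  (∀' ∼(((1 + 1) * &0) =' 1)) ⊓
  ∼(sumFourSqFormula 0 (-1)) ⊓
  (∀' (sumFourSqFormula 1 (&0) ⊔ sumFourSqFormula 1 (-&0))) ⊓
  (∀' (sumFourSqFormula 1 (&0) ⟹ (&0 =' 0 ⊔ sumFourSqFormula 1 (&0 + -1)))) ⊓
  (∀' ∃' (∼(&1 =' 0) ⊓ ∀' (sumFourSqFormula 3 (&2) ⟹ sumFourSqFormula 3 (&0 + -&2) ⟹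
    ∼(&2 =' 0) ⟹ ∃' (&1 =' (&2 * &3)))))

theorem realize_intLikeSentence (A : Type) [CommRing A] :
    letI := FirstOrder.Ring.compatibleRingOfRing A
    A ⊨ intLikeSentence ↔ IntLike A := by
  let := FirstOrder.Ring.compatibleRingOfRing A
  rw [show IntLike A ↔ _ from
    ⟨fun ⟨a, b, c, d, e, f⟩ =>
      And.intro (And.intro (And.intro (And.intro (And.intro a b) c) d) e) f,
    fun ⟨⟨⟨⟨⟨a, b⟩, c⟩, d⟩, e⟩, f⟩ => ⟨a, b, c, d, e, f⟩⟩]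
  simp [intLikeSentence, sumFourSqFormula, IsSumFourSq, Language.Sentence.Realize,
    Language.Formula.Realize, Fin.snoc]

theorem intLike_int : IntLike ℤ where
  eq_zero_or_eq_zero x y h := mul_eq_zero.mp h
  two_mul_ne_one x := by omega
  not_isSumFourSq_neg_one := by rw [int_isSumFourSq_iff]; omega
  isSumFourSq_or_neg x := by simp only [int_isSumFourSq_iff]; omega
  eq_zero_or_sub_one x := by simp only [int_isSumFourSq_iff]; omega
  exists_common_multiple x := by
    refine ⟨(x.toNat.factorial : ℤ), by exact_mod_cast Nat.factorial_ne_zero _, ?_⟩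
    intro k hk hxk hk0
    rw [int_isSumFourSq_iff] at hk hxk
    lift k to ℕ using hk
    exact Int.natCast_dvd_natCast.mpr (Nat.dvd_factorial (by omega) (by omega))

namespace IntLike

variable {A : Type} [CommRing A]

theorem natCast_succ_ne_zero (h : IntLike A) (n : ℕ) : ((n + 1 : ℕ) : A) ≠ 0 := by
  intro h0
  refine h.not_isSumFourSq_neg_one ?_
  have : (n : A) = -1 := by push_cast at h0; linear_combination h0
  exact this ▸ isSumFourSq_natCast n

theorem isSumFourSq_sub_natCast (h : IntLike A) {x : A} (hx : IsSumFourSq x)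
    (hne : ∀ n : ℕ, x ≠ n) (n : ℕ) : IsSumFourSq (x + -n) := by
  induction n with
  | zero => simpa using hx
  | succ n ih =>
    rcases h.eq_zero_or_sub_one _ ih with h0 | h1
    · exact absurd (by linear_combination h0) (hne n)
    · convert h1 using 1
      push_cast
      ring

theorem exists_eq_natCast [IsNoetherianRing A] (h : IntLike A) {x : A} (hx : IsSumFourSq x) :
    ∃ n : ℕ, x = n := by
  by_contra! hne
  have : Nontrivial A := ⟨_, _, h.natCast_succ_ne_zero 0⟩
  have : NoZeroDivisors A := ⟨fun {a b} => h.eq_zero_or_eq_zero a b⟩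
  have : IsDomain A := NoZeroDivisors.to_isDomain A
  obtain ⟨m, hm, hdvd⟩ := h.exists_common_multiple x
  have htop : Ideal.span {(2 : A)} ≠ ⊤ := by
    rw [Ne, Ideal.span_singleton_eq_top, isUnit_iff_exists_inv]
    rintro ⟨b, hb⟩
    exact h.two_mul_ne_one b (by linear_combination hb)
  have hmem : m ∈ ⨅ i : ℕ, Ideal.span {(2 : A)} ^ i := by
    refine Ideal.mem_iInf.mpr fun i => ?_
    rw [Ideal.span_singleton_pow, Ideal.mem_span_singleton]
    have hpow : ((2 ^ i : ℕ) : A) ≠ 0 := by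
      obtain ⟨k, hk⟩ := Nat.exists_eq_succ_of_ne_zero (pow_ne_zero i (two_ne_zero (α := ℕ)))
      rw [hk]
      exact h.natCast_succ_ne_zero k
    obtain ⟨l, hl⟩ := hdvd _ (isSumFourSq_natCast (2 ^ i))
      (h.isSumFourSq_sub_natCast hx hne _) hpow
    exact ⟨l, by simpa using hl⟩
  rw [Ideal.iInf_pow_eq_bot_of_isDomain _ htop] at hmem
  exact hm hmem

theorem bijective_intCast [IsNoetherianRing A] (h : IntLike A) :
    Function.Bijective (Int.castRingHom A) := by
  constructor
  · have : CharZero A := charZero_of_inj_zero fun n hn => by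
      cases n with
      | zero => rfl
      | succ n => exact absurd hn (h.natCast_succ_ne_zero n)
    exact Int.cast_injective
  · intro x
    rcases h.isSumFourSq_or_neg x with hx | hx
    · obtain ⟨n, rfl⟩ := h.exists_eq_natCast hx
      exact ⟨n, by simp⟩
    · obtain ⟨n, hn⟩ := h.exists_eq_natCast hx
      exact ⟨-n, by simp [← hn]⟩

end IntLike

/-- Nies's theorem: a commutative ring which is finitely generated (as a `ℤ`-algebra) and
elementarily equivalent to `ℤ` in the first-order language of rings is isomorphic to `ℤ`. -/
theorem int_first_order_rigid (R : Type) [CommRing R] (hfg : Algebra.FiniteType ℤ R)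
    (heq :
      letI := FirstOrder.Ring.compatibleRingOfRing R
      letI := FirstOrder.Ring.compatibleRingOfRing ℤ
      Language.ring.ElementarilyEquivalent R ℤ) :
    Nonempty (R ≃+* ℤ) := by
  let := FirstOrder.Ring.compatibleRingOfRing R
  let := FirstOrder.Ring.compatibleRingOfRing ℤ
  have hR : IntLike R := (realize_intLikeSentence R).mp <|
    (Language.elementarilyEquivalent_iff.mp heq intLikeSentence).mpr <|
      (realize_intLikeSentence ℤ).mpr intLike_int
  have : IsNoetherianRing R := Algebra.FiniteType.isNoetherianRing ℤ R
  exact ⟨(RingEquiv.ofBijective _ hR.bijective_intCast).symm⟩
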